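/- arXiv:2305.03330 — 7 statements merged into one kernel-verified Lean document; each statement's English description precedes it below -/
import Mathlib

section
/- Under Assumption (A), the map F is continuously differentiable on ℝ^Q, and for every x ∈ ℝ^Q the determinant of its Jacobian matrix DF(x) satisfies det(DF(x)) = (−1)^Q · (∏_{q=1}^Q ∑_{m=1}^M s^{[q]}_m ζ_m(x))^{−1} · ∑_{β ⊆ {1,…,M}, #β = Q} (∏_{i∈β} ζ_i(x)) · det(S[⟨Q⟩,β]) · det(B[⟨Q⟩,β]). -/
open scoped BigOperators

/-- `ζ_m(x) = exp(-∑_k b_{km} x_k)`. -/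
noncomputable def zeta {K M : ℕ} (B : Matrix (Fin K) (Fin M) ℝ)
    (x : Fin K → ℝ) (m : Fin M) : ℝ :=
  Real.exp (-(∑ k, B k m * x k))

/-- The map `F : ℝ^K → ℝ^Q` (with `Q = K`), `F_q(x) = ln ∑_m s^{[q]}_m ζ_m(x)`. -/
noncomputable def Fmap {K M : ℕ} (S B : Matrix (Fin K) (Fin M) ℝ)
    (x : Fin K → ℝ) : Fin K → ℝ :=
  fun q => Real.log (∑ m, S q m * zeta B x m)

/-- The minor `det(A[α,β])` of a matrix `A`, for index sets `α`, `β` with `#β = #α`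
(junk value `0` when the cardinalities differ). -/
noncomputable def minor {q m : ℕ} (A : Matrix (Fin q) (Fin m) ℝ)
    (α : Finset (Fin q)) (β : Finset (Fin m)) : ℝ :=
  if h : β.card = α.card then
    Matrix.det (Matrix.of fun i j : Fin α.card =>
      A (α.orderIsoOfFin rfl i) (β.orderIsoOfFin h j))
  else 0

/-- The Jacobian matrix of a map `ℝ^K → ℝ^K` at a point, as a `K × K` matrix. -/
noncomputable def jacobian {K : ℕ} (F : (Fin K → ℝ) → (Fin K → ℝ))
    (x : Fin K → ℝ) : Matrix (Fin K) (Fin K) ℝ :=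
  LinearMap.toMatrix' (fderiv ℝ F x).toLinearMap

theorem minor_univ_eq {q m : ℕ} (A : Matrix (Fin q) (Fin m) ℝ) (β : Finset (Fin m))
    (h : β.card = q) :
    minor A Finset.univ β = (A.submatrix id (β.orderEmbOfFin h)).det := by
  have hc : (Finset.univ : Finset (Fin q)).card = q := by simp
  have h' : β.card = (Finset.univ : Finset (Fin q)).card := by rw [h, hc]
  have key : ∀ (n : ℕ) (hn : n = q) (hu : (Finset.univ : Finset (Fin q)).card = n)
      (hb : β.card = n),
      Matrix.det (Matrix.of fun i j : Fin n =>
        A ((Finset.univ : Finset (Fin q)).orderIsoOfFin hu i) (β.orderIsoOfFin hb j)) =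
      (A.submatrix id (β.orderEmbOfFin h)).det := by
    intro n hn hu hb
    subst hn
    congr 1
    ext i j
    have h1 : (id : Fin n → Fin n) = (Finset.univ : Finset (Fin n)).orderEmbOfFin hu :=
      Finset.orderEmbOfFin_unique hu (by simp) strictMono_id
    have h2 := congrFun h1 i
    simp only [Matrix.of_apply, Matrix.submatrix_apply, Finset.coe_orderIsoOfFin_apply]
    rw [← h2]
  unfold minor
  rw [dif_pos h']
  exact key _ hc rfl h'

theorem cauchy_binet_weighted {K M : ℕ} (S B : Matrix (Fin K) (Fin M) ℝ) (w : Fin M → ℝ) :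
    (Matrix.of fun q k : Fin K => ∑ m, S q m * (w m * B k m)).det =
      ∑ β ∈ Finset.powersetCard K (Finset.univ : Finset (Fin M)),
        (∏ i ∈ β, w i) * (minor S Finset.univ β * minor B Finset.univ β) := by
  have e1 : (Matrix.of fun q k : Fin K => ∑ m, S q m * (w m * B k m)).det =
      ∑ f : Fin K → Fin M, (∏ i, (w (f i) * B i (f i))) * (S.submatrix id f).det := by
    rw [Matrix.det_apply']
    simp only [Matrix.of_apply, Finset.prod_univ_sum, Fintype.piFinset_univ, Finset.mul_sum]
    rw [Finset.sum_comm]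
    refine Finset.sum_congr rfl fun f _ => ?_
    rw [Matrix.det_apply', Finset.mul_sum]
    refine Finset.sum_congr rfl fun σ _ => ?_
    simp only [Finset.prod_mul_distrib, Matrix.submatrix_apply, id]
    ring
  rw [e1]
  classical
  have e2 : ∑ f : Fin K → Fin M, (∏ i, (w (f i) * B i (f i))) * (S.submatrix id f).det =
      ∑ f ∈ Finset.univ.filter (fun f : Fin K → Fin M => Function.Injective f),
        (∏ i, (w (f i) * B i (f i))) * (S.submatrix id f).det := by
    symm
    apply Finset.sum_subset (Finset.filter_subset _ _)
    intro f _ hf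
    have hf2 : ¬ Function.Injective f := fun h => hf (Finset.mem_filter.2 ⟨Finset.mem_univ _, h⟩)
    rw [Function.not_injective_iff] at hf2
    obtain ⟨i, j, hij, hne⟩ := hf2
    rw [Matrix.det_zero_of_column_eq hne (by intro k; simp [hij]), mul_zero]
  rw [e2, ← Finset.sum_fiberwise_of_maps_to (g := fun f => Finset.univ.image f)
    (t := Finset.powersetCard K (Finset.univ : Finset (Fin M)))]
  swap
  · intro f hf
    simp only [Finset.mem_filter, Finset.mem_univ, true_and] at hf
    simp [Finset.mem_powersetCard, Finset.card_image_of_injective _ hf]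
  refine Finset.sum_congr rfl fun β hβ => ?_
  have hc : β.card = K := (Finset.mem_powersetCard.1 hβ).2
  rw [minor_univ_eq S β hc, minor_univ_eq B β hc]
  set e := β.orderEmbOfFin hc with he
  have himg : Finset.univ.image e = β := Finset.image_orderEmbOfFin_univ β hc
  have e3 : ∑ f ∈ (Finset.univ.filter (fun f : Fin K → Fin M => Function.Injective f)).filter
        (fun f => Finset.univ.image f = β),
        (∏ i, (w (f i) * B i (f i))) * (S.submatrix id f).det =
      ∑ σ : Equiv.Perm (Fin K), (∏ i, (w (e (σ i)) * B i (e (σ i)))) *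
        (S.submatrix id (fun i => e (σ i))).det := by
    symm
    refine Finset.sum_bij (fun σ _ i => e (σ i)) ?_ ?_ ?_ ?_
    · intro σ _
      simp only [Finset.mem_filter, Finset.mem_univ, true_and]
      refine ⟨e.injective.comp σ.injective, ?_⟩
      rw [← himg]
      ext m
      simp only [Finset.mem_image, Finset.mem_univ, true_and]
      exact ⟨fun ⟨a, h⟩ => ⟨σ a, h⟩, fun ⟨a, h⟩ => ⟨σ.symm a, by simpa using h⟩⟩
    · intro σ _ τ _ h
      ext i
      exact congrArg _ (e.injective (congrFun h i))
    · intro f hf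
      simp only [Finset.mem_filter, Finset.mem_univ, true_and] at hf
      obtain ⟨hinj, hf⟩ := hf
      have hex : ∀ i, ∃ j, e j = f i := by
        intro i
        have : f i ∈ Finset.univ.image e := by
          rw [himg, ← hf]; exact Finset.mem_image_of_mem _ (Finset.mem_univ _)
        simpa using this
      choose g hg using hex
      have gi : Function.Injective g := by
        intro a b hab
        apply hinj
        rw [← hg, ← hg, hab]
      exact ⟨Equiv.ofBijective g (Finite.injective_iff_bijective.1 gi), Finset.mem_univ _,
        funext fun i => by simpa using hg i⟩
    · intro σ _
      rfl
  rw [e3]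
  have hw : ∀ σ : Equiv.Perm (Fin K), ∏ i, w (e (σ i)) = ∏ i ∈ β, w i := by
    intro σ
    rw [Equiv.prod_comp σ (fun i => w (e i)), ← himg,
      Finset.prod_image (fun a _ b _ h => e.injective h)]
  have hdet : ∀ σ : Equiv.Perm (Fin K), (S.submatrix id (fun i => e (σ i))).det =
      (Equiv.Perm.sign σ : ℝ) * (S.submatrix id e).det := by
    intro σ
    exact Matrix.det_permute' σ (S.submatrix id e)
  have hBd : (B.submatrix id e).det =
      ∑ σ : Equiv.Perm (Fin K), (Equiv.Perm.sign σ : ℝ) * ∏ i, B i (e (σ i)) := by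
    rw [← Matrix.det_transpose, Matrix.det_apply']
    rfl
  rw [hBd, Finset.mul_sum, Finset.mul_sum]
  refine Finset.sum_congr rfl fun σ _ => ?_
  rw [Finset.prod_mul_distrib, hw, hdet]
  ring

theorem sum_zeta_pos {K M : ℕ} (S B : Matrix (Fin K) (Fin M) ℝ)
    (hS : ∀ q m, 0 ≤ S q m) (hSrow : ∀ q, ∑ m, S q m = 1) (x : Fin K → ℝ) (q : Fin K) :
    0 < ∑ m, S q m * zeta B x m := by
  have hz : ∀ m, 0 < zeta B x m := fun m => Real.exp_pos _
  apply Finset.sum_pos' (fun m _ => mul_nonneg (hS q m) (hz m).le)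
  by_contra hcon
  push Not at hcon
  have : ∑ m, S q m = 0 := Finset.sum_eq_zero fun m hm => by
    have h1 := hcon m hm
    have h2 := hS q m
    have h3 := hz m
    by_contra hne
    have : 0 < S q m := lt_of_le_of_ne h2 (Ne.symm hne)
    have := mul_pos this h3
    linarith
  rw [hSrow] at this
  exact one_ne_zero this

theorem contDiff_Fmap {K M : ℕ} (S B : Matrix (Fin K) (Fin M) ℝ)
    (hS : ∀ q m, 0 ≤ S q m) (hSrow : ∀ q, ∑ m, S q m = 1) : ContDiff ℝ 1 (Fmap S B) := by
  rw [contDiff_pi]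
  intro q
  unfold Fmap
  apply ContDiff.log
  · unfold zeta
    fun_prop
  · intro x
    exact (sum_zeta_pos S B hS hSrow x q).ne'

theorem jacobian_apply {K M : ℕ} (S B : Matrix (Fin K) (Fin M) ℝ)
    (hS : ∀ q m, 0 ≤ S q m) (hSrow : ∀ q, ∑ m, S q m = 1) (x : Fin K → ℝ) (q k : Fin K) :
    jacobian (Fmap S B) x q k =
      (-(∑ m, S q m * zeta B x m)⁻¹) * ∑ m, S q m * (zeta B x m * B k m) := by
  have hd : DifferentiableAt ℝ (Fmap S B) x :=
    (contDiff_Fmap S B hS hSrow).differentiable one_ne_zero x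
  have hline : HasDerivAt (fun t : ℝ => x + t • (Pi.single k 1 : Fin K → ℝ))
      (Pi.single k 1) 0 := by
    simpa using ((hasDerivAt_id (0 : ℝ)).smul_const (Pi.single k 1 : Fin K → ℝ)).const_add x
  have hx0 : x + (0 : ℝ) • (Pi.single k 1 : Fin K → ℝ) = x := by simp
  have h1 : HasDerivAt (fun t : ℝ => Fmap S B (x + t • (Pi.single k 1 : Fin K → ℝ)))
      (fderiv ℝ (Fmap S B) x (Pi.single k 1)) 0 := by
    have hF : HasFDerivAt (Fmap S B) (fderiv ℝ (Fmap S B) x)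
      (x + (0 : ℝ) • (Pi.single k 1 : Fin K → ℝ)) := by rw [hx0]; exact hd.hasFDerivAt
    exact hF.comp_hasDerivAt (0 : ℝ) hline
  have h2 := (hasDerivAt_pi.1 h1) q
  have hz : ∀ m, HasDerivAt (fun t : ℝ => zeta B (x + t • (Pi.single k 1 : Fin K → ℝ)) m)
      (-(zeta B x m * B k m)) 0 := by
    intro m
    have hs : HasDerivAt (fun t : ℝ =>
        -(∑ j, B j m * (x + t • (Pi.single k 1 : Fin K → ℝ)) j)) (-(B k m)) 0 := by
      have : HasDerivAt (fun t : ℝ =>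
        -(∑ j, B j m * (x + t • (Pi.single k 1 : Fin K → ℝ)) j))
          (-(∑ j, B j m * (Pi.single k 1 : Fin K → ℝ) j)) 0 :=
        (HasDerivAt.fun_sum fun j _ => ((hasDerivAt_pi.1 hline) j).const_mul (B j m)).neg
      simpa [Pi.single_apply] using this
    have := hs.exp
    rw [hx0] at this
    rw [mul_neg] at this
    exact this
  have h3 : HasDerivAt (fun t : ℝ => Fmap S B (x + t • (Pi.single k 1 : Fin K → ℝ)) q)
      ((∑ m, S q m * (-(zeta B x m * B k m))) / (∑ m, S q m * zeta B x m)) 0 := by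
    have hs : HasDerivAt (fun t : ℝ =>
        ∑ m, S q m * zeta B (x + t • (Pi.single k 1 : Fin K → ℝ)) m)
        (∑ m, S q m * (-(zeta B x m * B k m))) 0 :=
      HasDerivAt.fun_sum fun m _ => (hz m).const_mul (S q m)
    have := hs.log (by rw [hx0]; exact (sum_zeta_pos S B hS hSrow x q).ne')
    rw [hx0] at this
    exact this
  have h4 := h2.unique h3
  have h5 : jacobian (Fmap S B) x q k = fderiv ℝ (Fmap S B) x (Pi.single k 1) q := by
    simp [jacobian, LinearMap.toMatrix'_apply]
  rw [h5, h4]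
  simp only [mul_neg, Finset.sum_neg_distrib]
  ring

/-- Under Assumption (A), `F` is continuously differentiable and the
determinant of its Jacobian is given by the Cauchy–Binet type expansion. -/
theorem jacobian_det_formula (K M : ℕ) (hK : 1 ≤ K) (hMK : K ≤ M)
    (S B : Matrix (Fin K) (Fin M) ℝ)
    (hS : ∀ q m, 0 ≤ S q m) (hB : ∀ k m, 0 < B k m)
    (hScol : ∀ m, ∃ q, S q m ≠ 0)
    (hSrow : ∀ q, ∑ m, S q m = 1) :
    ContDiff ℝ 1 (Fmap S B) ∧
      ∀ x : Fin K → ℝ,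
        (jacobian (Fmap S B) x).det =
          (-1 : ℝ) ^ K * (∏ q, ∑ m, S q m * zeta B x m)⁻¹ *
            ∑ β ∈ Finset.powersetCard K (Finset.univ : Finset (Fin M)),
              (∏ i ∈ β, zeta B x i) *
                (minor S Finset.univ β * minor B Finset.univ β) := by
  refine ⟨contDiff_Fmap S B hS hSrow, fun x => ?_⟩
  have hJ : jacobian (Fmap S B) x = Matrix.of fun q k =>
      (-(∑ m, S q m * zeta B x m)⁻¹) *
        (Matrix.of fun q k : Fin K => ∑ m, S q m * (zeta B x m * B k m)) q k := by
    ext q k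
    exact jacobian_apply S B hS hSrow x q k
  rw [hJ, Matrix.det_mul_column, cauchy_binet_weighted, Finset.prod_neg, Finset.prod_inv_distrib]
  simp
end

section
/- Assume Assumption (A). If there exist indices k₁ ≠ k₂ in {1,…,K} and an index m₀ ∈ {1,…,M} such that b_{k₁ m₀}/b_{k₂ m₀} = max_{1 ≤ m ≤ M} b_{k₁ m}/b_{k₂ m} and s^{[q]}_{m₀} > 0 for all q = 1,…,Q, then F is not a proper mapping, i.e., it is not the case that ‖F(x)‖ → ∞ as ‖x‖ → ∞. -/
open scoped BigOperators

/-- The map `F : ℝ^K → ℝ^Q` (with `Q = K`), `F_q(x) = ln ∑_m s^{[q]}_m ζ_m(x)`,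
viewed as a map on Euclidean space (so `‖·‖` is the Euclidean norm). -/
noncomputable def FmapE {K M : ℕ} (S B : Matrix (Fin K) (Fin M) ℝ)
    (x : EuclideanSpace ℝ (Fin K)) : EuclideanSpace ℝ (Fin K) :=
  WithLp.toLp 2 fun q => Real.log (∑ m, S q m * Real.exp (-(∑ k, B k m * x k)))

/-- A map `H : ℝ^n → ℝ^n` is proper if `‖H(x)‖ → ∞` as `‖x‖ → ∞`. -/
def ProperMap {K : ℕ} (H : EuclideanSpace ℝ (Fin K) → EuclideanSpace ℝ (Fin K)) : Prop :=
  Filter.Tendsto (fun x => ‖H x‖)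
    (Filter.comap (fun x : EuclideanSpace ℝ (Fin K) => ‖x‖) Filter.atTop) Filter.atTop

/-- Under Assumption (A), if there are indices `k₁ ≠ k₂` and `m₀`
attaining `max_m b_{k₁m}/b_{k₂m}` with `s^{[q]}_{m₀} > 0` for all `q`, then `F` is not
a proper mapping. -/
theorem Fmap_not_proper (K M : ℕ) (hK : 1 ≤ K) (hMK : K ≤ M)
    (S B : Matrix (Fin K) (Fin M) ℝ)
    (hS : ∀ q m, 0 ≤ S q m) (hB : ∀ k m, 0 < B k m)
    (hScol : ∀ m, ∃ q, S q m ≠ 0)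
    (hSrow : ∀ q, ∑ m, S q m = 1)
    (k₁ k₂ : Fin K) (hk : k₁ ≠ k₂) (m₀ : Fin M)
    (hmax : ∀ m, B k₁ m / B k₂ m ≤ B k₁ m₀ / B k₂ m₀)
    (hpos : ∀ q, 0 < S q m₀) :
    ¬ ProperMap (FmapE S B) := by
  intro hP
  set v : EuclideanSpace ℝ (Fin K) :=
    EuclideanSpace.single k₂ (B k₁ m₀) - EuclideanSpace.single k₁ (B k₂ m₀) with hv
  have hv0 : v ≠ 0 := by
    intro h
    have h2 : v k₂ = 0 := by rw [h]; rfl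
    have h3 := hB k₁ m₀
    simp [hv, hk.symm] at h2
    linarith
  have hsum : ∀ (t : ℝ) m, ∑ k, B k m * (t • v) k
      = t * (B k₂ m * B k₁ m₀ - B k₁ m * B k₂ m₀) := by
    intro t m
    simp only [hv, PiLp.smul_apply, PiLp.sub_apply, EuclideanSpace.single_apply, smul_eq_mul,
      mul_sub, Finset.sum_sub_distrib]
    simp
    ring
  have hx : Filter.Tendsto (fun t : ℝ => t • v) Filter.atTop
      (Filter.comap (fun x : EuclideanSpace ℝ (Fin K) => ‖x‖) Filter.atTop) := by
    rw [Filter.tendsto_comap_iff]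
    have : Filter.Tendsto (fun t : ℝ => |t| * ‖v‖) Filter.atTop Filter.atTop :=
      Filter.tendsto_abs_atTop_atTop.atTop_mul_const (norm_pos_iff.mpr hv0)
    refine this.congr ?_
    intro t
    simp [norm_smul]
  have hT := Filter.Tendsto.comp hP hx
  set w : EuclideanSpace ℝ (Fin K) := WithLp.toLp 2 fun q => Real.log (S q m₀) with hw
  obtain ⟨t, ht1, ht0⟩ :=
    ((hT.eventually_gt_atTop ‖w‖).and (Filter.eventually_ge_atTop (0:ℝ))).exists
  refine absurd ht1 (not_lt.mpr ?_)
  simp only [Function.comp]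
  rw [EuclideanSpace.norm_eq, EuclideanSpace.norm_eq]
  apply Real.sqrt_le_sqrt
  apply Finset.sum_le_sum
  intro q _
  have hlow : S q m₀ ≤ ∑ m, S q m * Real.exp (-(∑ k, B k m * (t • v) k)) := by
    have := Finset.single_le_sum (f := fun m => S q m * Real.exp (-(∑ k, B k m * (t • v) k)))
      (fun m _ => mul_nonneg (hS q m) (Real.exp_pos _).le) (Finset.mem_univ m₀)
    have h0 : S q m₀ * Real.exp (-(∑ k, B k m₀ * (t • v) k)) = S q m₀ := by
      rw [hsum, mul_comm (B k₂ m₀)]; simp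
    simp only [h0] at this
    exact this
  have hup : ∑ m, S q m * Real.exp (-(∑ k, B k m * (t • v) k)) ≤ 1 := by
    rw [← hSrow q]
    apply Finset.sum_le_sum
    intro m _
    apply mul_le_of_le_one_right (hS q m)
    rw [Real.exp_le_one_iff, hsum, neg_nonpos]
    apply mul_nonneg ht0
    have := hmax m
    rw [div_le_div_iff₀ (hB _ _) (hB _ _)] at this
    linarith
  have h1 := Real.log_le_log (hpos q) hlow
  have h2 := Real.log_nonpos ((hpos q).le.trans hlow) hup
  apply pow_le_pow_left₀ (norm_nonneg _)
  simp only [FmapE, hw, Real.norm_eq_abs]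
  rw [abs_of_nonpos h2, abs_of_nonpos (h1.trans h2)]
  linarith
end

section
/- Assume Assumption (A). Suppose there exists a nonzero x ∈ ℝ^K such that Bᵀx ≥ 0 componentwise, and there exists an index m₀ ∈ {1,…,M} with (Bᵀx)_{m₀} = 0 and s^{[q]}_{m₀} > 0 for all q = 1,…,Q. Then F is not a proper mapping, i.e., it is not the case that ‖F(y)‖ → ∞ as ‖y‖ → ∞. -/
open scoped BigOperators

/-- Under Assumption (A), if there is a nonzero `x` with `Bᵀx ≥ 0`
componentwise and an index `m₀` with `(Bᵀx)_{m₀} = 0` and `s^{[q]}_{m₀} > 0` for all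
`q`, then `F` is not a proper mapping. -/
theorem Fmap_not_proper_general (K M : ℕ) (hK : 1 ≤ K) (hMK : K ≤ M)
    (S B : Matrix (Fin K) (Fin M) ℝ)
    (hS : ∀ q m, 0 ≤ S q m) (hB : ∀ k m, 0 < B k m)
    (hScol : ∀ m, ∃ q, S q m ≠ 0)
    (hSrow : ∀ q, ∑ m, S q m = 1)
    (x : Fin K → ℝ) (hx : x ≠ 0)
    (hBx : ∀ m, 0 ≤ ∑ k, B k m * x k)
    (m₀ : Fin M) (hm₀ : ∑ k, B k m₀ * x k = 0)
    (hpos : ∀ q, 0 < S q m₀) :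
    ¬ ProperMap (FmapE S B) := by
  intro h
  unfold ProperMap at h
  have hxn : 0 < ‖(WithLp.toLp 2 x : EuclideanSpace ℝ (Fin K))‖ := by
    rw [norm_pos_iff]
    intro h0
    apply hx
    funext k
    have := congrArg (fun v : EuclideanSpace ℝ (Fin K) => v k) h0
    simpa using this
  have hray : Filter.Tendsto
      (fun t : ℝ => t • (WithLp.toLp 2 x : EuclideanSpace ℝ (Fin K))) Filter.atTop
      (Filter.comap (fun x : EuclideanSpace ℝ (Fin K) => ‖x‖) Filter.atTop) := by
    rw [Filter.tendsto_comap_iff]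
    have h1 : Filter.Tendsto
        (fun t : ℝ => |t| * ‖(WithLp.toLp 2 x : EuclideanSpace ℝ (Fin K))‖)
        Filter.atTop Filter.atTop :=
      Filter.tendsto_abs_atTop_atTop.atTop_mul_const hxn
    refine h1.congr fun t => ?_
    simp [Function.comp, norm_smul]
  have h2 := h.comp hray
  set C : ℝ := ‖(WithLp.toLp 2 (fun q => Real.log (S q m₀)) : EuclideanSpace ℝ (Fin K))‖ with hC
  obtain ⟨t, ht1, ht0⟩ :=
    ((h2.eventually (Filter.eventually_gt_atTop C)).and (Filter.eventually_ge_atTop 0)).exists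
  refine absurd ht1 (not_lt.mpr ?_)
  simp only [Function.comp]
  rw [hC, EuclideanSpace.norm_eq, EuclideanSpace.norm_eq]
  apply Real.sqrt_le_sqrt
  apply Finset.sum_le_sum
  intro q _
  have hsum : ∀ m, ∑ k, B k m * (t • (WithLp.toLp 2 x : EuclideanSpace ℝ (Fin K))) k
      = t * ∑ k, B k m * x k := by
    intro m
    rw [Finset.mul_sum]
    refine Finset.sum_congr rfl fun k _ => ?_
    simp only [PiLp.smul_apply, smul_eq_mul]
    ring
  have hlow : S q m₀ ≤ ∑ m, S q m * Real.exp (-(t * ∑ k, B k m * x k)) := by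
    have := Finset.single_le_sum (f := fun m => S q m * Real.exp (-(t * ∑ k, B k m * x k)))
      (fun m _ => mul_nonneg (hS q m) (Real.exp_pos _).le) (Finset.mem_univ m₀)
    simpa [hm₀] using this
  have hup : ∑ m, S q m * Real.exp (-(t * ∑ k, B k m * x k)) ≤ 1 := by
    rw [← hSrow q]
    refine Finset.sum_le_sum fun m _ => ?_
    apply mul_le_of_le_one_right (hS q m)
    rw [Real.exp_le_one_iff]
    have := mul_nonneg ht0 (hBx m)
    linarith
  have hl1 := Real.log_le_log (hpos q) hlow
  have hl2 := Real.log_nonpos ((hpos q).le.trans hlow) hup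
  simp only [FmapE, hsum, Real.norm_eq_abs, sq_abs]
  nlinarith
end

section
/- Let Q = K = 2 and assume Assumption (A). Suppose that for each ordered pair (k,l) ∈ {(1,2),(2,1)} there exists q = q(k,l) ∈ {1,2} such that s^{[q]}_m = 0 for every m ∈ 𝓜(k,l), where 𝓜(k,l) := {m : b_{km}/b_{lm} = max_{m'} b_{km'}/b_{lm'}}. Then there exist constants c > 0 and R > 0 such that ‖F(x)‖ ≥ c‖x‖ for every x ∈ ℝ² with ‖x‖ ≥ R. -/
open scoped BigOperators

lemma dect_aux {M : ℕ} (S B : Matrix (Fin 2) (Fin M) ℝ)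
    (hB : ∀ k m, 0 < B k m)
    (hvanish : ∀ k l : Fin 2, k ≠ l → ∃ q : Fin 2, ∀ m : Fin M,
      (∀ m', B k m' / B l m' ≤ B k m / B l m) → S q m = 0)
    (k l : Fin 2) (hkl : k ≠ l) (y z : ℝ) (hz : 0 < z)
    (h1 : ∀ m, 0 ≤ B k m * y + B l m * z)
    (h2 : ∀ q, ∃ m, S q m ≠ 0 ∧ B k m * y + B l m * z = 0) : False := by
  obtain ⟨q, hq⟩ := hvanish k l hkl
  obtain ⟨m, hm, he⟩ := h2 q
  refine hm (hq m fun m' => ?_)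
  rw [div_le_div_iff₀ (hB l m') (hB l m)]
  have a := mul_nonneg (hB k m).le (h1 m')
  have b : B k m' * (B k m * y + B l m * z) = 0 := by rw [he, mul_zero]
  refine le_of_mul_le_mul_right ?_ hz
  nlinarith

noncomputable def dectG {M : ℕ} (S B : Matrix (Fin 2) (Fin M) ℝ)
    (h : ∀ q, (Finset.univ.filter (fun m => S q m ≠ 0)).Nonempty) (q : Fin 2)
    (x : EuclideanSpace ℝ (Fin 2)) : ℝ :=
  (Finset.univ.filter (fun m => S q m ≠ 0)).sup' (h q)
    (fun m => -(B 0 m * x 0 + B 1 m * x 1))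

/-- In DECT (`Q = K = 2`), under Assumption (A) and the vanishing
condition of `S` on the maximizer sets `𝓜(k,l)`, there are constants `c > 0` and
`R > 0` such that `‖F(x)‖ ≥ c‖x‖` whenever `‖x‖ ≥ R`. -/
theorem Fmap_linear_growth_DECT (M : ℕ) (hM : 2 ≤ M)
    (S B : Matrix (Fin 2) (Fin M) ℝ)
    (hS : ∀ q m, 0 ≤ S q m) (hB : ∀ k m, 0 < B k m)
    (hScol : ∀ m, ∃ q, S q m ≠ 0)
    (hSrow : ∀ q, ∑ m, S q m = 1)
    (hvanish : ∀ k l : Fin 2, k ≠ l → ∃ q : Fin 2, ∀ m : Fin M,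
      (∀ m', B k m' / B l m' ≤ B k m / B l m) → S q m = 0) :
    ∃ c > (0 : ℝ), ∃ R > (0 : ℝ), ∀ x : EuclideanSpace ℝ (Fin 2),
      R ≤ ‖x‖ → c * ‖x‖ ≤ ‖FmapE S B x‖ := by
  have h : ∀ q, (Finset.univ.filter (fun m => S q m ≠ 0)).Nonempty := by
    intro q
    by_contra hne
    rw [Finset.not_nonempty_iff_eq_empty, Finset.filter_eq_empty_iff] at hne
    have h0 : ∑ m, S q m = 0 := Finset.sum_eq_zero fun m hm => by
      simpa using hne hm
    rw [hSrow q] at h0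
    exact one_ne_zero h0
  have gle : ∀ q x m, S q m ≠ 0 → -(B 0 m * x 0 + B 1 m * x 1) ≤ dectG S B h q x := by
    intro q x m hm
    exact Finset.le_sup' (fun m => -(B 0 m * x 0 + B 1 m * x 1)) (by simp [hm])
  have gex : ∀ q x, ∃ m, S q m ≠ 0 ∧ dectG S B h q x = -(B 0 m * x 0 + B 1 m * x 1) := by
    intro q x
    obtain ⟨m, hm, he⟩ := Finset.exists_mem_eq_sup' (h q) (fun m => -(B 0 m * x 0 + B 1 m * x 1))
    exact ⟨m, by simpa using hm, he⟩
  have gcont : ∀ q, Continuous (dectG S B h q) := by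
    intro q
    unfold dectG
    apply Continuous.finset_sup'_apply
    intro m _
    fun_prop
  have ghom : ∀ q (r : ℝ) x, 0 ≤ r → dectG S B h q (r • x) = r * dectG S B h q x := by
    intro q r x hr
    apply le_antisymm
    · obtain ⟨m, hm, he⟩ := gex q (r • x)
      have := mul_le_mul_of_nonneg_left (gle q x m hm) hr
      rw [he]
      simp only [PiLp.smul_apply, smul_eq_mul]
      linarith
    · obtain ⟨m, hm, he⟩ := gex q x
      have := gle q (r • x) m hm
      rw [he]
      simp only [PiLp.smul_apply, smul_eq_mul] at this
      linarith
  have gpos : ∀ x : EuclideanSpace ℝ (Fin 2), x ≠ 0 →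
      0 < |dectG S B h 0 x| + |dectG S B h 1 x| := by
    intro x hx
    by_contra hcon
    have h0 : ∀ q, dectG S B h q x = 0 := by
      have a0 := abs_nonneg (dectG S B h 0 x)
      have a1 := abs_nonneg (dectG S B h 1 x)
      intro q
      rw [← abs_eq_zero]
      fin_cases q
      · show |dectG S B h 0 x| = 0
        linarith
      · show |dectG S B h 1 x| = 0
        linarith
    have h1 : ∀ m, 0 ≤ B 0 m * x 0 + B 1 m * x 1 := by
      intro m
      obtain ⟨q, hq⟩ := hScol m
      have := gle q x m hq
      rw [h0 q] at this
      linarith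
    have h2 : ∀ q, ∃ m, S q m ≠ 0 ∧ B 0 m * x 0 + B 1 m * x 1 = 0 := by
      intro q
      obtain ⟨m, hm, he⟩ := gex q x
      rw [h0 q] at he
      exact ⟨m, hm, by linarith⟩
    obtain ⟨m, hm, he⟩ := h2 0
    have b0 := hB 0 m
    have b1 := hB 1 m
    rcases lt_trichotomy (x 0) 0 with hx0 | hx0 | hx0
    · have hx1 : 0 < x 1 := by
        by_contra hc
        nlinarith
      exact dect_aux S B hB hvanish 0 1 (by decide) (x 0) (x 1) hx1 h1 h2
    · apply hx
      have hx1 : x 1 = 0 := by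
        rw [hx0, mul_zero, zero_add] at he
        exact (mul_eq_zero.mp he).resolve_left b1.ne'
      ext i
      fin_cases i
      · simpa using hx0
      · simpa using hx1
    · refine dect_aux S B hB hvanish 1 0 (by decide) (x 1) (x 0) hx0 (fun m => ?_) (fun q => ?_)
      · rw [add_comm]; exact h1 m
      · obtain ⟨m, hm, he⟩ := h2 q
        exact ⟨m, hm, by rw [add_comm]; exact he⟩
  obtain ⟨c0, hc0, hgc⟩ : ∃ c0 > 0, ∀ x : EuclideanSpace ℝ (Fin 2),
      c0 * ‖x‖ ≤ |dectG S B h 0 x| + |dectG S B h 1 x| := by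
    have hcomp : IsCompact (Metric.sphere (0 : EuclideanSpace ℝ (Fin 2)) 1) := isCompact_sphere _ _
    have hne : (Metric.sphere (0 : EuclideanSpace ℝ (Fin 2)) 1).Nonempty :=
      NormedSpace.sphere_nonempty.mpr zero_le_one
    obtain ⟨u, hu, hmin⟩ := hcomp.exists_isMinOn hne
      (((gcont 0).abs.add (gcont 1).abs).continuousOn)
    have hu0 : u ≠ 0 := by
      rintro rfl
      simp at hu
    refine ⟨_, gpos u hu0, fun x => ?_⟩
    by_cases hx : x = 0
    · subst hx
      simp only [norm_zero, mul_zero]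
      positivity
    have hn : 0 < ‖x‖ := norm_pos_iff.mpr hx
    have hv : ‖x‖⁻¹ • x ∈ Metric.sphere (0 : EuclideanSpace ℝ (Fin 2)) 1 := by
      simp [norm_smul, hn.ne']
    have hm := hmin hv
    simp only [Set.mem_ofPred_eq, Pi.add_apply] at hm
    rw [ghom _ _ _ (by positivity), ghom _ _ _ (by positivity), abs_mul, abs_mul,
      abs_of_pos (inv_pos.mpr hn), ← mul_add] at hm
    have := mul_le_mul_of_nonneg_right hm hn.le
    refine this.trans (le_of_eq ?_)
    field_simp
  set C : ℝ := ∑ q, ∑ m, |Real.log (S q m)| with hC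
  have hClog : ∀ q m, |Real.log (S q m)| ≤ C := by
    intro q m
    refine (Finset.single_le_sum (f := fun m => |Real.log (S q m)|)
      (fun _ _ => abs_nonneg _) (Finset.mem_univ m)).trans ?_
    exact Finset.single_le_sum (f := fun q => ∑ m, |Real.log (S q m)|)
      (fun _ _ => Finset.sum_nonneg fun _ _ => abs_nonneg _) (Finset.mem_univ q)
  have hC0 : 0 ≤ C := Finset.sum_nonneg fun _ _ => Finset.sum_nonneg fun _ _ => abs_nonneg _
  have hF : ∀ q x, |dectG S B h q x| ≤ ‖FmapE S B x‖ + C := by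
    intro q x
    have hn : |FmapE S B x q| ≤ ‖FmapE S B x‖ := by
      simpa using PiLp.norm_apply_le (FmapE S B x) q
    have hdef : FmapE S B x q
        = Real.log (∑ m, S q m * Real.exp (-(B 0 m * x 0 + B 1 m * x 1))) := by
      simp [FmapE, Fin.sum_univ_two]
    obtain ⟨m, hm, he⟩ := gex q x
    have hSm : 0 < S q m := lt_of_le_of_ne (hS q m) (Ne.symm hm)
    have hlow : S q m * Real.exp (dectG S B h q x)
        ≤ ∑ m, S q m * Real.exp (-(B 0 m * x 0 + B 1 m * x 1)) := by
      rw [he]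
      exact Finset.single_le_sum
        (f := fun m => S q m * Real.exp (-(B 0 m * x 0 + B 1 m * x 1)))
        (fun i _ => mul_nonneg (hS q i) (Real.exp_pos _).le) (Finset.mem_univ m)
    have hup : ∑ m, S q m * Real.exp (-(B 0 m * x 0 + B 1 m * x 1))
        ≤ Real.exp (dectG S B h q x) := by
      calc _ ≤ ∑ m, S q m * Real.exp (dectG S B h q x) := by
            refine Finset.sum_le_sum fun i _ => ?_
            by_cases hi : S q i = 0
            · simp [hi]
            · exact mul_le_mul_of_nonneg_left (Real.exp_le_exp.mpr (gle q x i hi)) (hS q i)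
        _ = _ := by rw [← Finset.sum_mul, hSrow, one_mul]
    have hp : 0 < S q m * Real.exp (dectG S B h q x) := mul_pos hSm (Real.exp_pos _)
    have l1 := Real.log_le_log hp hlow
    have l2 := Real.log_le_log (hp.trans_le hlow) hup
    rw [Real.log_exp] at l2
    rw [Real.log_mul hSm.ne' (Real.exp_pos _).ne', Real.log_exp] at l1
    rw [← hdef] at l1 l2
    have l3 := abs_le.mp (hClog q m)
    have l4 := abs_le.mp hn
    rw [abs_le]
    constructor <;> linarith [l3.1, l3.2, l4.1, l4.2]
  refine ⟨c0 / 4, by positivity, 4 * C / c0 + 1, by positivity, fun x hx => ?_⟩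
  have a := hgc x
  have b0 := hF 0 x
  have b1 := hF 1 x
  have d : 4 * C + c0 ≤ c0 * ‖x‖ := by
    have := mul_le_mul_of_nonneg_left hx hc0.le
    have e : c0 * (4 * C / c0 + 1) = 4 * C + c0 := by field_simp
    linarith
  linarith
end

section
/- Let Q = K = 2 and assume Assumption (A). Suppose det(S Bᵀ) ≠ 0 and the family of products {det(S[⟨2⟩,β]) · det(B[⟨2⟩,β]) : β ⊆ {1,…,M}, #β = 2} is either all nonnegative or all nonpositive. Suppose furthermore that for each ordered pair (k,l) ∈ {(1,2),(2,1)} there exists q = q(k,l) ∈ {1,2} such that s^{[q]}_m = 0 for every m ∈ 𝓜(k,l), where 𝓜(k,l) := {m : b_{km}/b_{lm} = max_{m'} b_{km'}/b_{lm'}}. Then F is a homeomorphism of ℝ² onto ℝ²; in particular, for every g ∈ ℝ² there exists a unique x ∈ ℝ² with F(x) = g. -/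
open scoped BigOperators

theorem aux_minor {M : ℕ} (A : Matrix (Fin 2) (Fin M) ℝ) (m n : Fin M) (h : m < n) :
    minor A Finset.univ {m, n} = A 0 m * A 1 n - A 0 n * A 1 m := by
  have hc : ({m, n} : Finset (Fin M)).card = (Finset.univ : Finset (Fin 2)).card := by
    rw [Finset.card_pair h.ne]; rfl
  unfold minor
  rw [dif_pos hc]
  have key1 : ∀ f : Fin 2 ≃o (Finset.univ : Finset (Fin 2)),
      (f 0 : Fin 2) = 0 ∧ (f 1 : Fin 2) = 1 := by
    intro f
    have : (f 0 : Fin 2) < f 1 := f.strictMono (by decide)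
    omega
  have key2 : ∀ f : Fin 2 ≃o ({m, n} : Finset (Fin M)),
      (f 0 : Fin M) = m ∧ (f 1 : Fin M) = n := by
    intro f
    have h1 : (f 0 : Fin M) < f 1 := f.strictMono (by decide)
    have h2 := (f 0).2
    have h3 := (f 1).2
    simp only [Finset.mem_insert, Finset.mem_singleton] at h2 h3
    rcases h2 with h2 | h2 <;> rcases h3 with h3 | h3 <;> rw [h2, h3] at h1 ⊢
    · exact absurd h1 (lt_irrefl _)
    · simp
    · exact absurd h1 (lt_asymm h)
    · exact absurd h1 (lt_irrefl _)
  have gen : ∀ (c : ℕ) (_ : c = 2) (f : Fin c ≃o (Finset.univ : Finset (Fin 2)))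
      (g : Fin c ≃o ({m, n} : Finset (Fin M))),
      Matrix.det (Matrix.of fun i j : Fin c => A (f i) (g j))
        = A 0 m * A 1 n - A 0 n * A 1 m := by
    intro c hc2 f g
    subst hc2
    rw [Matrix.det_fin_two]
    simp only [Matrix.of_apply, (key1 f).1, (key1 f).2, (key2 g).1, (key2 g).2]
  exact gen _ (Finset.card_fin 2) _ _

def TT {M : ℕ} (S B : Matrix (Fin 2) (Fin M) ℝ) (m n : Fin M) : ℝ :=
  (S 0 m * S 1 n - S 0 n * S 1 m) * (B 0 m * B 1 n - B 0 n * B 1 m)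

theorem aux_T_all {M : ℕ} (S B : Matrix (Fin 2) (Fin M) ℝ) (P : ℝ → Prop) (h0 : P 0)
    (h : ∀ β ∈ Finset.powersetCard 2 (Finset.univ : Finset (Fin M)),
        P (minor S Finset.univ β * minor B Finset.univ β)) (m n : Fin M) : P (TT S B m n) := by
  have main : ∀ m n : Fin M, m < n → P (TT S B m n) := by
    intro m n hmn
    have := h {m, n} (by simp [Finset.mem_powersetCard, Finset.card_pair hmn.ne])
    rwa [aux_minor S m n hmn, aux_minor B m n hmn] at this
  rcases lt_trichotomy m n with h1 | h1 | h1
  · exact main m n h1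
  · subst h1; simpa [TT] using h0
  · have := main n m h1
    have e : TT S B m n = TT S B n m := by unfold TT; ring
    rwa [e]

theorem aux_cb {M : ℕ} (S B : Matrix (Fin 2) (Fin M) ℝ) (c : Fin M → ℝ) :
    2 * ((∑ m, S 0 m * c m * B 0 m) * (∑ m, S 1 m * c m * B 1 m)
      - (∑ m, S 0 m * c m * B 1 m) * (∑ m, S 1 m * c m * B 0 m))
      = ∑ m, ∑ n, c m * c n * TT S B m n := by
  have e1 : (∑ m, S 0 m * c m * B 0 m) * (∑ m, S 1 m * c m * B 1 m)
      = (∑ m, S 1 m * c m * B 1 m) * (∑ m, S 0 m * c m * B 0 m) := mul_comm _ _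
  have e2 : (∑ m, S 0 m * c m * B 1 m) * (∑ m, S 1 m * c m * B 0 m)
      = (∑ m, S 1 m * c m * B 0 m) * (∑ m, S 0 m * c m * B 1 m) := mul_comm _ _
  rw [two_mul]
  nth_rewrite 2 [e1, e2]
  simp only [Finset.sum_mul_sum, ← Finset.sum_sub_distrib, ← Finset.sum_add_distrib]
  refine Finset.sum_congr rfl fun m _ => Finset.sum_congr rfl fun n _ => ?_
  unfold TT; ring

theorem aux_det {M : ℕ} (S B : Matrix (Fin 2) (Fin M) ℝ)
    (hdet : (S * B.transpose).det ≠ 0)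
    (hsign :
      (∀ β ∈ Finset.powersetCard 2 (Finset.univ : Finset (Fin M)),
        0 ≤ minor S Finset.univ β * minor B Finset.univ β) ∨
      (∀ β ∈ Finset.powersetCard 2 (Finset.univ : Finset (Fin M)),
        minor S Finset.univ β * minor B Finset.univ β ≤ 0))
    (c : Fin M → ℝ) (hc : ∀ m, 0 < c m) :
    (∑ m, S 0 m * c m * B 0 m) * (∑ m, S 1 m * c m * B 1 m)
      - (∑ m, S 0 m * c m * B 1 m) * (∑ m, S 1 m * c m * B 0 m) ≠ 0 := by
  have hex : ∃ m n, TT S B m n ≠ 0 := by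
    by_contra! hcon
    apply hdet
    have := aux_cb S B (fun _ => 1)
    simp only [hcon, mul_zero, Finset.sum_const_zero, mul_one] at this
    rw [Matrix.det_fin_two]
    simp only [Matrix.mul_apply, Matrix.transpose_apply]
    linarith
  obtain ⟨m, n, hmn⟩ := hex
  intro h0
  have e := aux_cb S B c
  rw [h0, mul_zero] at e
  have main : ∀ σ : ℝ, σ ≠ 0 → (∀ m n, 0 ≤ σ * TT S B m n) → False := by
    intro σ hσ hp
    have e' : ∑ m, ∑ n, c m * c n * (σ * TT S B m n) = 0 := by
      have : ∑ m, ∑ n, c m * c n * (σ * TT S B m n) = σ * ∑ m, ∑ n, c m * c n * TT S B m n := by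
        simp only [Finset.mul_sum]
        refine Finset.sum_congr rfl fun m _ => Finset.sum_congr rfl fun n _ => ?_
        ring
      rw [this, ← e, mul_zero]
    have nn : ∀ m n, 0 ≤ c m * c n * (σ * TT S B m n) := fun m n =>
      mul_nonneg (mul_nonneg (hc m).le (hc n).le) (hp m n)
    rw [Finset.sum_eq_zero_iff_of_nonneg (fun m _ => Finset.sum_nonneg fun n _ => nn m n)] at e'
    have e2 := e' m (Finset.mem_univ _)
    rw [Finset.sum_eq_zero_iff_of_nonneg (fun n _ => nn m n)] at e2
    have e3 := e2 n (Finset.mem_univ _)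
    have := (hc m).ne'
    have := (hc n).ne'
    simp only [mul_eq_zero] at e3
    tauto
  rcases hsign with h | h
  · exact main 1 one_ne_zero fun m n => by
      simpa using aux_T_all S B (fun t => 0 ≤ t) le_rfl h m n
  · exact main (-1) (by norm_num) fun m n => by
      simpa using aux_T_all S B (fun t => t ≤ 0) le_rfl h m n

theorem aux_mvt (a b : ℝ) : ∃ c : ℝ, 0 < c ∧ Real.exp (-b) - Real.exp (-a) = c * (a - b) := by
  rcases eq_or_ne a b with h | h
  · exact ⟨1, one_pos, by simp [h]⟩
  · refine ⟨(Real.exp (-b) - Real.exp (-a)) / (a - b), ?_, ?_⟩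
    · rcases lt_or_gt_of_ne h with h | h
      · apply div_pos_of_neg_of_neg
        · have := Real.exp_lt_exp.2 (neg_lt_neg h); linarith
        · linarith
      · apply div_pos
        · have := Real.exp_lt_exp.2 (neg_lt_neg h); linarith
        · linarith
    · have : a - b ≠ 0 := sub_ne_zero.2 h
      field_simp

theorem aux_zeta {M : ℕ} (B : Matrix (Fin 2) (Fin M) ℝ) (x : Fin 2 → ℝ) (m : Fin M) :
    zeta B x m = Real.exp (-(B 0 m * x 0 + B 1 m * x 1)) := by
  simp [zeta, Fin.sum_univ_two]

theorem aux_pos {M : ℕ} (S B : Matrix (Fin 2) (Fin M) ℝ)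
    (hS : ∀ q m, 0 ≤ S q m) (hSrow : ∀ q, ∑ m, S q m = 1) (x : Fin 2 → ℝ) (q : Fin 2) :
    0 < ∑ m, S q m * zeta B x m := by
  have hz : ∀ m, 0 < zeta B x m := fun m => Real.exp_pos _
  have hex : ∃ m, S q m ≠ 0 := by
    by_contra! h
    have := hSrow q
    simp [h] at this
  obtain ⟨m, hm⟩ := hex
  exact Finset.sum_pos' (fun i _ => mul_nonneg (hS q i) (hz i).le)
    ⟨m, Finset.mem_univ _, mul_pos (lt_of_le_of_ne (hS q m) hm.symm) (hz m)⟩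

theorem aux_lin (p q r s u v : ℝ) (hd : p * s - q * r ≠ 0) (h1 : p * u + q * v = 0)
    (h2 : r * u + s * v = 0) : u = 0 ∧ v = 0 := by
  constructor
  · apply (mul_eq_zero.1 (_ : (p * s - q * r) * u = 0)).resolve_left hd
    linear_combination s * h1 - q * h2
  · apply (mul_eq_zero.1 (_ : (p * s - q * r) * v = 0)).resolve_left hd
    linear_combination p * h2 - r * h1

theorem aux_inj {M : ℕ} (S B : Matrix (Fin 2) (Fin M) ℝ)
    (hS : ∀ q m, 0 ≤ S q m) (hSrow : ∀ q, ∑ m, S q m = 1)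
    (hD : ∀ c : Fin M → ℝ, (∀ m, 0 < c m) →
      (∑ m, S 0 m * c m * B 0 m) * (∑ m, S 1 m * c m * B 1 m)
      - (∑ m, S 0 m * c m * B 1 m) * (∑ m, S 1 m * c m * B 0 m) ≠ 0) :
    Function.Injective (Fmap S B) := by
  intro x y hxy
  have hq : ∀ q, ∑ m, S q m * zeta B x m = ∑ m, S q m * zeta B y m := fun q =>
    Real.log_injOn_pos (aux_pos S B hS hSrow x q) (aux_pos S B hS hSrow y q) (congrFun hxy q)
  choose c hc hce using fun m => aux_mvt (B 0 m * x 0 + B 1 m * x 1) (B 0 m * y 0 + B 1 m * y 1)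
  have hl : ∀ q, (∑ m, S q m * c m * B 0 m) * (x 0 - y 0)
      + (∑ m, S q m * c m * B 1 m) * (x 1 - y 1) = 0 := by
    intro q
    have h := hq q
    rw [eq_comm, ← sub_eq_zero, ← Finset.sum_sub_distrib] at h
    rw [← h, Finset.sum_mul, Finset.sum_mul, ← Finset.sum_add_distrib]
    refine Finset.sum_congr rfl fun m _ => ?_
    rw [aux_zeta, aux_zeta, ← mul_sub, hce]; ring
  obtain ⟨h0, h1⟩ := aux_lin _ _ _ _ _ _ (hD c hc) (hl 0) (hl 1)
  ext i
  fin_cases i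
  · exact sub_eq_zero.1 h0
  · exact sub_eq_zero.1 h1

noncomputable def FD {M : ℕ} (S B : Matrix (Fin 2) (Fin M) ℝ) (x : Fin 2 → ℝ) :
    (Fin 2 → ℝ) →L[ℝ] (Fin 2 → ℝ) :=
  ContinuousLinearMap.pi fun q => (∑ m, S q m * zeta B x m)⁻¹ •
    ∑ m, S q m • (zeta B x m • (-(∑ k, B k m • ContinuousLinearMap.proj (R := ℝ) (φ := fun _ : Fin 2 => ℝ) k)))

theorem aux_deriv {M : ℕ} (S B : Matrix (Fin 2) (Fin M) ℝ)
    (hS : ∀ q m, 0 ≤ S q m) (hSrow : ∀ q, ∑ m, S q m = 1) (x : Fin 2 → ℝ) :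
    HasStrictFDerivAt (Fmap S B) (FD S B x) x := by
  rw [hasStrictFDerivAt_pi']
  intro q
  have h1 : ∀ m, HasStrictFDerivAt (fun x => zeta B x m)
      (zeta B x m • (-(∑ k, B k m • ContinuousLinearMap.proj (R := ℝ) (φ := fun _ : Fin 2 => ℝ) k))) x := by
    intro m
    unfold zeta
    apply HasStrictFDerivAt.exp
    apply HasStrictFDerivAt.neg
    apply HasStrictFDerivAt.fun_sum
    intro k _
    exact ((ContinuousLinearMap.proj (R := ℝ) (φ := fun _ : Fin 2 => ℝ) k).hasStrictFDerivAt).const_mul (B k m)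
  have h2 : HasStrictFDerivAt (fun x => ∑ m, S q m * zeta B x m)
      (∑ m, S q m • (zeta B x m • (-(∑ k, B k m • ContinuousLinearMap.proj (R := ℝ) (φ := fun _ : Fin 2 => ℝ) k)))) x :=
    HasStrictFDerivAt.fun_sum fun m _ => (h1 m).const_mul (S q m)
  exact h2.log (aux_pos S B hS hSrow x q).ne'

theorem aux_FD_inj {M : ℕ} (S B : Matrix (Fin 2) (Fin M) ℝ)
    (hS : ∀ q m, 0 ≤ S q m) (hSrow : ∀ q, ∑ m, S q m = 1)
    (hD : ∀ c : Fin M → ℝ, (∀ m, 0 < c m) →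
      (∑ m, S 0 m * c m * B 0 m) * (∑ m, S 1 m * c m * B 1 m)
      - (∑ m, S 0 m * c m * B 1 m) * (∑ m, S 1 m * c m * B 0 m) ≠ 0) (x : Fin 2 → ℝ) :
    Function.Injective (FD S B x) := by
  rw [injective_iff_map_eq_zero]
  intro d hd
  have hl : ∀ q, (∑ m, S q m * zeta B x m * B 0 m) * d 0
      + (∑ m, S q m * zeta B x m * B 1 m) * d 1 = 0 := by
    intro q
    have h := congrFun hd q
    simp only [FD, ContinuousLinearMap.pi_apply, ContinuousLinearMap.smul_apply, Pi.zero_apply,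
      smul_eq_mul] at h
    have h := (mul_eq_zero.1 h).resolve_left (inv_ne_zero (aux_pos S B hS hSrow x q).ne')
    simp only [ContinuousLinearMap.sum_apply, ContinuousLinearMap.smul_apply, smul_eq_mul,
      ContinuousLinearMap.neg_apply, Fin.sum_univ_two, ContinuousLinearMap.add_apply,
      ContinuousLinearMap.proj_apply] at h
    rw [← neg_eq_zero, ← h, Finset.sum_mul, Finset.sum_mul, ← Finset.sum_add_distrib,
      ← Finset.sum_neg_distrib]
    refine Finset.sum_congr rfl fun m _ => ?_
    ring
  obtain ⟨h0, h1⟩ := aux_lin _ _ _ _ _ _ (hD (zeta B x) fun m => Real.exp_pos _) (hl 0) (hl 1)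
  ext i
  fin_cases i
  · exact h0
  · exact h1

theorem aux_open {M : ℕ} (S B : Matrix (Fin 2) (Fin M) ℝ)
    (hS : ∀ q m, 0 ≤ S q m) (hSrow : ∀ q, ∑ m, S q m = 1)
    (hD : ∀ c : Fin M → ℝ, (∀ m, 0 < c m) →
      (∑ m, S 0 m * c m * B 0 m) * (∑ m, S 1 m * c m * B 1 m)
      - (∑ m, S 0 m * c m * B 1 m) * (∑ m, S 1 m * c m * B 0 m) ≠ 0) :
    IsOpenMap (Fmap S B) := by
  rw [isOpenMap_iff_nhds_le]
  intro x
  have hsurj : Function.Surjective (FD S B x) :=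
    (LinearMap.injective_iff_surjective (f := (FD S B x).toLinearMap)).1
      (aux_FD_inj S B hS hSrow hD x)
  exact ((aux_deriv S B hS hSrow x).map_nhds_eq_of_surj
    (LinearMap.range_eq_top.2 hsurj)).ge

theorem aux_low {M : ℕ} (S B : Matrix (Fin 2) (Fin M) ℝ)
    (hS : ∀ q m, 0 ≤ S q m) (hScol : ∀ m, ∃ q, S q m ≠ 0) (hSrow : ∀ q, ∑ m, S q m = 1)
    (C : ℝ) (m : Fin M) : ∃ R : ℝ, ∀ x, (∀ q, |Fmap S B x q| ≤ C) →
      -R ≤ B 0 m * x 0 + B 1 m * x 1 := by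
  obtain ⟨q, hq⟩ := hScol m
  have hq : 0 < S q m := lt_of_le_of_ne (hS q m) hq.symm
  refine ⟨C - Real.log (S q m), fun x hx => ?_⟩
  have h1 := (abs_le.1 (hx q)).2
  have hz : ∀ m, 0 < zeta B x m := fun m => Real.exp_pos _
  have h2 : S q m * zeta B x m ≤ ∑ m, S q m * zeta B x m :=
    Finset.single_le_sum (f := fun m => S q m * zeta B x m)
      (fun i _ => mul_nonneg (hS q i) (hz i).le) (Finset.mem_univ m)
  have h3 := Real.log_le_log (mul_pos hq (hz m)) h2
  rw [Real.log_mul hq.ne' (hz m).ne', aux_zeta, Real.log_exp] at h3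
  unfold Fmap at h1
  linarith

theorem aux_up {M : ℕ} (S B : Matrix (Fin 2) (Fin M) ℝ)
    (hS : ∀ q m, 0 ≤ S q m) (hSrow : ∀ q, ∑ m, S q m = 1)
    (C : ℝ) (x : Fin 2 → ℝ) (hx : ∀ q, |Fmap S B x q| ≤ C) (q : Fin 2) :
    ∃ m, S q m ≠ 0 ∧ B 0 m * x 0 + B 1 m * x 1 ≤ C := by
  by_contra! hcon
  have h1 := (abs_le.1 (hx q)).1
  unfold Fmap at h1
  rw [Real.le_log_iff_exp_le (aux_pos S B hS hSrow x q)] at h1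
  have hex : ∃ m, S q m ≠ 0 := by
    by_contra! h
    have := hSrow q
    simp [h] at this
  obtain ⟨m, hm⟩ := hex
  have lt : ∀ m, S q m ≠ 0 → S q m * zeta B x m < S q m * Real.exp (-C) := by
    intro m hm
    apply mul_lt_mul_of_pos_left _ (lt_of_le_of_ne (hS q m) hm.symm)
    rw [aux_zeta]
    exact Real.exp_lt_exp.2 (neg_lt_neg (hcon m hm))
  have h2 : ∑ m, S q m * zeta B x m < ∑ m, S q m * Real.exp (-C) := by
    apply Finset.sum_lt_sum
    · intro i _
      by_cases hi : S q i = 0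
      · simp [hi]
      · exact (lt i hi).le
    · exact ⟨m, Finset.mem_univ _, lt m hm⟩
  rw [← Finset.sum_mul, hSrow, one_mul] at h2
  linarith

theorem aux_coord {M : ℕ} (hM : 2 ≤ M) (S B : Matrix (Fin 2) (Fin M) ℝ)
    (hS : ∀ q m, 0 ≤ S q m) (hB : ∀ k m, 0 < B k m)
    (hScol : ∀ m, ∃ q, S q m ≠ 0) (hSrow : ∀ q, ∑ m, S q m = 1)
    (hvanish : ∀ k l : Fin 2, k ≠ l → ∃ q : Fin 2, ∀ m : Fin M,
      (∀ m', B k m' / B l m' ≤ B k m / B l m) → S q m = 0)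
    (C : ℝ) (k l : Fin 2) (hkl : k ≠ l) : ∃ R : ℝ, ∀ x, (∀ q, |Fmap S B x q| ≤ C) →
      -R ≤ x k := by
  have hsum : ∀ m (x : Fin 2 → ℝ), B 0 m * x 0 + B 1 m * x 1 = B k m * x k + B l m * x l := by
    intro m x
    fin_cases k <;> fin_cases l <;> first | exact absurd rfl hkl | rfl | exact add_comm _ _
  have : Nonempty (Fin M) := ⟨⟨0, by omega⟩⟩
  obtain ⟨m0, hm0⟩ := Finite.exists_max (fun m => B k m / B l m)
  obtain ⟨q, hq⟩ := hvanish k l hkl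
  obtain ⟨R0, hR0⟩ := aux_low S B hS hScol hSrow C m0
  have hm : ∀ m, ∃ R : ℝ, S q m ≠ 0 → ∀ x : Fin 2 → ℝ, -R0 ≤ B 0 m0 * x 0 + B 1 m0 * x 1 →
      B 0 m * x 0 + B 1 m * x 1 ≤ C → -R ≤ x k := by
    intro m
    by_cases hmq : S q m = 0
    · exact ⟨0, fun h => absurd hmq h⟩
    have hlt : B k m / B l m < B k m0 / B l m0 := by
      apply lt_of_le_of_ne (hm0 m)
      intro h
      exact hmq (hq m fun m' => by rw [h]; exact hm0 m')
    rw [div_lt_div_iff₀ (hB _ _) (hB _ _)] at hlt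
    have hg : 0 < B k m0 * B l m - B k m * B l m0 := by linarith
    refine ⟨(R0 * B l m + C * B l m0) / (B k m0 * B l m - B k m * B l m0), fun _ x h1 h2 => ?_⟩
    rw [hsum] at h1 h2
    have h3 := mul_le_mul_of_nonneg_right h1 (hB l m).le
    have h4 := mul_le_mul_of_nonneg_right h2 (hB l m0).le
    rw [← neg_div, div_le_iff₀ hg]
    linarith
  choose R hR using hm
  refine ⟨∑ m, |R m|, fun x hx => ?_⟩
  obtain ⟨m, hmq, hmx⟩ := aux_up S B hS hSrow C x hx q
  have h1 := hR m hmq x (hR0 x hx) hmx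
  have h2 : |R m| ≤ ∑ m, |R m| :=
    Finset.single_le_sum (f := fun m => |R m|) (fun i _ => abs_nonneg _) (Finset.mem_univ m)
  have := le_abs_self (R m)
  linarith

theorem aux_coord_up {M : ℕ} (hM : 2 ≤ M) (S B : Matrix (Fin 2) (Fin M) ℝ)
    (hS : ∀ q m, 0 ≤ S q m) (hB : ∀ k m, 0 < B k m)
    (hScol : ∀ m, ∃ q, S q m ≠ 0) (hSrow : ∀ q, ∑ m, S q m = 1)
    (hvanish : ∀ k l : Fin 2, k ≠ l → ∃ q : Fin 2, ∀ m : Fin M,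
      (∀ m', B k m' / B l m' ≤ B k m / B l m) → S q m = 0)
    (C : ℝ) : ∃ R : ℝ, ∀ x, (∀ q, |Fmap S B x q| ≤ C) → ∀ k, |x k| ≤ R := by
  obtain ⟨R0, h0⟩ := aux_coord hM S B hS hB hScol hSrow hvanish C 0 1 (by decide)
  obtain ⟨R1, h1⟩ := aux_coord hM S B hS hB hScol hSrow hvanish C 1 0 (by decide)
  let U : Fin M → ℝ := fun m => |(C + B 1 m * R1) / B 0 m| + |(C + B 0 m * R0) / B 1 m|
  refine ⟨|R0| + |R1| + ∑ m, U m, fun x hx => ?_⟩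
  have a0 := h0 x hx
  have a1 := h1 x hx
  obtain ⟨m, -, hm⟩ := aux_up S B hS hSrow C x hx 0
  have hU : U m ≤ ∑ m, U m :=
    Finset.single_le_sum (f := U) (fun i _ => by positivity) (Finset.mem_univ m)
  have hU' : U m = |(C + B 1 m * R1) / B 0 m| + |(C + B 0 m * R0) / B 1 m| := rfl
  have b0 : x 0 ≤ (C + B 1 m * R1) / B 0 m := by
    rw [le_div_iff₀ (hB 0 m)]
    nlinarith [hB 1 m]
  have b1 : x 1 ≤ (C + B 0 m * R0) / B 1 m := by
    rw [le_div_iff₀ (hB 1 m)]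
    nlinarith [hB 0 m]
  have c0 := le_abs_self ((C + B 1 m * R1) / B 0 m)
  have c1 := le_abs_self ((C + B 0 m * R0) / B 1 m)
  have d0 := le_abs_self R0
  have d1 := le_abs_self R1
  have e0 := abs_nonneg R0
  have e1 := abs_nonneg R1
  have f0 := abs_nonneg ((C + B 1 m * R1) / B 0 m)
  have f1 := abs_nonneg ((C + B 0 m * R0) / B 1 m)
  intro k
  fin_cases k
  · change |x 0| ≤ _
    rw [abs_le]; constructor <;> linarith
  · change |x 1| ≤ _
    rw [abs_le]; constructor <;> linarith

/-- In DECT (`Q = K = 2`), under Assumption (A), the determinant and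
same-sign minor conditions, and the vanishing condition of `S` on the maximizer sets
`𝓜(k,l)`, the map `F` is a homeomorphism of `ℝ²` onto `ℝ²`; in particular for every
`g ∈ ℝ²` there is a unique `x` with `F(x) = g`. -/
theorem Fmap_homeomorphism_DECT (M : ℕ) (hM : 2 ≤ M)
    (S B : Matrix (Fin 2) (Fin M) ℝ)
    (hS : ∀ q m, 0 ≤ S q m) (hB : ∀ k m, 0 < B k m)
    (hScol : ∀ m, ∃ q, S q m ≠ 0)
    (hSrow : ∀ q, ∑ m, S q m = 1)
    (hdet : (S * B.transpose).det ≠ 0)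
    (hsign :
      (∀ β ∈ Finset.powersetCard 2 (Finset.univ : Finset (Fin M)),
        0 ≤ minor S Finset.univ β * minor B Finset.univ β) ∨
      (∀ β ∈ Finset.powersetCard 2 (Finset.univ : Finset (Fin M)),
        minor S Finset.univ β * minor B Finset.univ β ≤ 0))
    (hvanish : ∀ k l : Fin 2, k ≠ l → ∃ q : Fin 2, ∀ m : Fin M,
      (∀ m', B k m' / B l m' ≤ B k m / B l m) → S q m = 0) :
    (∃ H : (Fin 2 → ℝ) ≃ₜ (Fin 2 → ℝ), ⇑H = Fmap S B) ∧
      ∀ g : Fin 2 → ℝ, ∃! x : Fin 2 → ℝ, Fmap S B x = g := by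
  have hD := aux_det S B hdet hsign
  have hinj := aux_inj S B hS hSrow hD
  have hopen := aux_open S B hS hSrow hD
  have hcont : Continuous (Fmap S B) := continuous_iff_continuousAt.2 fun x =>
    (aux_deriv S B hS hSrow x).continuousAt
  have hproper : IsProperMap (Fmap S B) := by
    rw [isProperMap_iff_isCompact_preimage]
    refine ⟨hcont, fun {K} hK => ?_⟩
    obtain ⟨C, hC⟩ := hK.isBounded.exists_norm_le
    obtain ⟨R, hR⟩ := aux_coord_up hM S B hS hB hScol hSrow hvanish C
    apply Metric.isCompact_of_isClosed_isBounded (hK.isClosed.preimage hcont)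
    apply (Metric.isBounded_closedBall (x := (0 : Fin 2 → ℝ)) (r := R)).subset
    intro x hx
    have h := hR x fun q => (norm_le_pi_norm (Fmap S B x) q).trans (hC _ hx)
    rw [mem_closedBall_zero_iff]
    exact (pi_norm_le_iff_of_nonempty x).2 h
  have hsurj : Function.Surjective (Fmap S B) := by
    rw [← Set.range_eq_univ]
    exact IsClopen.eq_univ ⟨hproper.isClosedMap.isClosed_range, hopen.isOpen_range⟩
      (Set.range_nonempty _)
  refine ⟨⟨(Equiv.ofBijective _ ⟨hinj, hsurj⟩).toHomeomorphOfContinuousOpen hcont hopen, rfl⟩,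
    fun g => ?_⟩
  exact Function.Bijective.existsUnique ⟨hinj, hsurj⟩ g
end

section
/- Assume Assumption (A) and det(S Bᵀ) ≠ 0. Suppose that for all index sets α ⊆ {1,…,Q} and β ⊆ {1,…,M} with #β = #α, the products satisfy det(S[α,β]) · det(B[α,β]) ≥ 0. Then F is globally injective on ℝ^Q, i.e., F(x₁) = F(x₂) implies x₁ = x₂. -/
open scoped BigOperators

open Matrix Equiv in
lemma cb_expand {K M : ℕ} (S B : Matrix (Fin K) (Fin M) ℝ) (d : Fin M → ℝ) :
    (S * Matrix.diagonal d * B.transpose).det =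
      ∑ p : Fin K → Fin M, (∏ i, d (p i)) * (∏ i, B i (p i)) *
        (Matrix.of fun i j => S i (p j)).det := by
  have hE : ∀ i j, (S * Matrix.diagonal d * B.transpose) i j = ∑ m, S i m * d m * B j m := by
    intro i j
    rw [mul_apply]
    simp only [mul_diagonal, transpose_apply]
  simp only [det_apply', hE, transpose_apply, Finset.prod_univ_sum,
    Finset.mul_sum, Fintype.piFinset_univ, of_apply]
  rw [Finset.sum_comm]
  refine Finset.sum_congr rfl fun p _ => Finset.sum_congr rfl fun σ _ => ?_
  simp only [Finset.prod_mul_distrib]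
  ring

open Matrix Equiv in
lemma cb {K M : ℕ} (S B : Matrix (Fin K) (Fin M) ℝ) (d : Fin M → ℝ) :
    (Fintype.card (Perm (Fin K)) : ℝ) * (S * Matrix.diagonal d * B.transpose).det =
      ∑ p : Fin K → Fin M, (∏ i, d (p i)) *
        ((Matrix.of fun i j => S i (p j)).det * (Matrix.of fun i j => B i (p j)).det) := by
  have key : ∀ τ : Perm (Fin K), (S * Matrix.diagonal d * B.transpose).det =
      ∑ p : Fin K → Fin M, (∏ i, d (p i)) * (∏ i, B i (p (τ i))) *
        ((Perm.sign τ : ℤ) * (Matrix.of fun i j => S i (p j)).det) := by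
    intro τ
    rw [cb_expand]
    refine (Fintype.sum_equiv (Equiv.arrowCongr τ (Equiv.refl (Fin M))) _ _ fun p => ?_)
    have h1 : ∀ i, (Equiv.arrowCongr τ (Equiv.refl (Fin M))) p i = p (τ.symm i) := fun i => rfl
    simp only [h1, Equiv.symm_apply_apply]
    rw [Equiv.prod_comp τ.symm (fun i => d (p i))]
    have h2 : (Matrix.of fun i j => S i (p (τ.symm j))).det =
        (Perm.sign τ : ℤ) * (Matrix.of fun i j => S i (p j)).det := by
      have := det_permute' τ.symm (Matrix.of fun i j => S i (p j))
      rw [Perm.sign_symm] at this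
      rw [← this]; rfl
    rw [h2, ← mul_assoc ((Perm.sign τ : ℤ) : ℝ)]
    have h3 : (((Perm.sign τ : ℤ) : ℝ)) * ((Perm.sign τ : ℤ) : ℝ) = 1 := by
      rcases Int.units_eq_one_or (Perm.sign τ) with h | h <;> simp [h]
    rw [h3, one_mul]
  rw [← nsmul_eq_mul, ← Finset.card_univ, ← Finset.sum_const]
  rw [Finset.sum_congr rfl fun τ _ => key τ, Finset.sum_comm]
  refine Finset.sum_congr rfl fun p _ => ?_
  rw [← det_transpose (Matrix.of fun i j => B i (p j)), det_apply' (Matrix.transpose _)]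
  simp only [Finset.mul_sum, transpose_apply, of_apply]
  refine Finset.sum_congr rfl fun τ _ => ?_
  ring

open Matrix Equiv in
lemma term_nonneg {K M : ℕ} (S B : Matrix (Fin K) (Fin M) ℝ)
    (hsign : ∀ (α : Finset (Fin K)) (β : Finset (Fin M)), β.card = α.card →
      0 ≤ minor S α β * minor B α β) (p : Fin K → Fin M) :
    0 ≤ (Matrix.of fun i j => S i (p j)).det * (Matrix.of fun i j => B i (p j)).det := by
  by_cases hp : Function.Injective p
  · set β := Finset.univ.image p with hβ
    have hc : β.card = (Finset.univ : Finset (Fin K)).card := Finset.card_image_of_injective _ hp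
    have h0 := hsign Finset.univ β hc
    let e : Fin (Finset.univ : Finset (Fin K)).card ≃ Fin K :=
      ((Finset.univ : Finset (Fin K)).orderIsoOfFin rfl).toEquiv.trans
        (Equiv.subtypeUnivEquiv (by simp))
    have hex : ∀ j : Fin (Finset.univ : Finset (Fin K)).card,
        ∃ i, p i = (β.orderIsoOfFin hc j : Fin M) := by
      intro j
      obtain ⟨i, -, hi⟩ := Finset.mem_image.1 (β.orderIsoOfFin hc j).2
      exact ⟨i, hi⟩
    choose f hf using hex
    have hfi : Function.Injective f := by
      intro a b hab
      have : p (f a) = p (f b) := by rw [hab]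
      rw [hf, hf] at this
      exact (β.orderIsoOfFin hc).injective (Subtype.ext this)
    have hfb : Function.Bijective f :=
      (Fintype.bijective_iff_injective_and_card f).2 ⟨hfi, by simp⟩
    let f' := Equiv.ofBijective f hfb
    have hm : ∀ A : Matrix (Fin K) (Fin M) ℝ, minor A Finset.univ β =
        (Perm.sign (f'.symm.trans e) : ℤ) * (Matrix.of fun i j => A i (p j)).det := by
      intro A
      rw [← det_permute, ← det_submatrix_equiv_self f', minor, dif_pos hc]
      congr 1
      ext i j
      have h1 : p (f' j) = (β.orderIsoOfFin hc j : Fin M) := hf j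
      simp only [submatrix_apply, of_apply, id, h1, Equiv.trans_apply, Equiv.symm_apply_apply]
      rfl
    rw [hm, hm] at h0
    rcases Int.units_eq_one_or (Perm.sign (f'.symm.trans e)) with h | h <;> rw [h] at h0 <;>
      simpa using h0
  · have : (Matrix.of fun i j => S i (p j)).det = 0 := by
      simp only [Function.Injective, not_forall] at hp
      obtain ⟨a, b, hab, hne⟩ := hp
      exact det_zero_of_column_eq hne fun i => by simp [hab]
    simp [this]

lemma det_pos_of {K M : ℕ} (S B : Matrix (Fin K) (Fin M) ℝ)
    (hdet : (S * B.transpose).det ≠ 0)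
    (hsign : ∀ (α : Finset (Fin K)) (β : Finset (Fin M)), β.card = α.card →
      0 ≤ minor S α β * minor B α β) (d : Fin M → ℝ) (hd : ∀ m, 0 < d m) :
    (S * Matrix.diagonal d * B.transpose).det ≠ 0 := by
  intro h
  have h1 := cb S B d
  rw [h, mul_zero, eq_comm, Finset.sum_eq_zero_iff_of_nonneg] at h1
  · have h2 := cb S B 1
    rw [Finset.sum_eq_zero] at h2
    · have : (Fintype.card (Equiv.Perm (Fin K)) : ℝ) ≠ 0 := by
        exact_mod_cast Fintype.card_ne_zero
      apply hdet
      simpa [this] using h2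
    · intro p hp
      have h3 := h1 p hp
      have h4 : (∏ i, d (p i)) ≠ 0 := (Finset.prod_pos fun i _ => hd _).ne'
      rw [(mul_eq_zero.1 h3).resolve_left h4, mul_zero]
  · intro p _
    exact mul_nonneg (Finset.prod_nonneg fun i _ => (hd _).le) (term_nonneg S B hsign p)

lemma exp_diff (a b : ℝ) : ∃ d : ℝ, 0 < d ∧ Real.exp (-a) - Real.exp (-b) = d * (b - a) := by
  rcases lt_trichotomy a b with h | h | h
  · have : Real.exp (-b) < Real.exp (-a) := Real.exp_lt_exp.2 (by linarith)
    exact ⟨(Real.exp (-a) - Real.exp (-b)) / (b - a), div_pos (by linarith) (by linarith),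
      (div_mul_cancel₀ _ (by linarith)).symm⟩
  · exact ⟨1, one_pos, by simp [h]⟩
  · have : Real.exp (-a) < Real.exp (-b) := Real.exp_lt_exp.2 (by linarith)
    exact ⟨(Real.exp (-a) - Real.exp (-b)) / (b - a),
      div_pos_of_neg_of_neg (by linarith) (by linarith),
      (div_mul_cancel₀ _ (by linarith)).symm⟩

/-- Under Assumption (A), `det(S Bᵀ) ≠ 0`, and nonnegativity of all
products of corresponding minors of `S` and `B`, the map `F` is globally injective. -/
theorem Fmap_injective (K M : ℕ) (hK : 1 ≤ K) (hMK : K ≤ M)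
    (S B : Matrix (Fin K) (Fin M) ℝ)
    (hS : ∀ q m, 0 ≤ S q m) (hB : ∀ k m, 0 < B k m)
    (hScol : ∀ m, ∃ q, S q m ≠ 0)
    (hSrow : ∀ q, ∑ m, S q m = 1)
    (hdet : (S * B.transpose).det ≠ 0)
    (hsign : ∀ (α : Finset (Fin K)) (β : Finset (Fin M)), β.card = α.card →
      0 ≤ minor S α β * minor B α β) :
    Function.Injective (Fmap S B) := by
  intro x y hxy
  have hpos : ∀ (z : Fin K → ℝ) q, 0 < ∑ m, S q m * zeta B z m := by
    intro z q
    have hz : ∀ m, 0 < zeta B z m := fun m => Real.exp_pos _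
    have h0 : ∀ m ∈ Finset.univ, 0 ≤ S q m * zeta B z m :=
      fun m _ => mul_nonneg (hS q m) (hz m).le
    refine lt_of_le_of_ne (Finset.sum_nonneg h0) fun h => ?_
    rw [eq_comm, Finset.sum_eq_zero_iff_of_nonneg h0] at h
    have : ∑ m, S q m = 0 := Finset.sum_eq_zero fun m hm =>
      (mul_eq_zero.1 (h m hm)).resolve_right (hz m).ne'
    linarith [hSrow q]
  have heq : ∀ q, ∑ m, S q m * zeta B x m = ∑ m, S q m * zeta B y m := fun q =>
    Real.log_injOn_pos (hpos x q) (hpos y q) (congrFun hxy q)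
  choose d hd hd' using fun m => exp_diff (∑ k, B k m * x k) (∑ k, B k m * y k)
  have hdet' := det_pos_of S B hdet hsign d hd
  have hker : (S * Matrix.diagonal d * B.transpose).mulVec (y - x) = 0 := by
    rw [← Matrix.mulVec_mulVec, ← Matrix.mulVec_mulVec]
    ext q
    have h1 : ∀ m, (Matrix.diagonal d).mulVec (B.transpose.mulVec (y - x)) m
        = zeta B x m - zeta B y m := by
      intro m
      rw [Matrix.mulVec_diagonal, zeta, zeta, hd', ← Finset.sum_sub_distrib]
      simp [Matrix.mulVec, dotProduct, mul_sub]
    simp only [Matrix.mulVec, dotProduct] at h1 ⊢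
    simp only [h1, mul_sub, Finset.sum_sub_distrib, heq q, sub_self, Pi.zero_apply]
  have := Matrix.eq_zero_of_mulVec_eq_zero hdet' hker
  exact (sub_eq_zero.1 this).symm
end

section
/- Let Q = K = 2 and assume Assumption (A). Suppose det(S Bᵀ) ≠ 0 and the family of products {det(S[⟨2⟩,β]) · det(B[⟨2⟩,β]) : β ⊆ {1,…,M}, #β = 2} is either all nonnegative or all nonpositive. Then F is globally injective on ℝ². -/
open scoped BigOperators

/-- Every minor is, for a common choice of column ordering, a 2x2 determinant. -/
theorem minor_prod_aux {M : ℕ} (S B : Matrix (Fin 2) (Fin M) ℝ) (m n : Fin M) (hmn : m ≠ n) :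
    minor S Finset.univ {m, n} * minor B Finset.univ {m, n} =
      (S 0 m * S 1 n - S 0 n * S 1 m) * (B 0 m * B 1 n - B 0 n * B 1 m) := by
  have hc : ({m, n} : Finset (Fin M)).card = (Finset.univ : Finset (Fin 2)).card := by
    rw [Finset.card_pair hmn]; rfl
  let e : Fin (Finset.univ : Finset (Fin 2)).card ≃ Fin 2 :=
    ((Finset.univ : Finset (Fin 2)).orderIsoOfFin rfl).toEquiv.trans
      (Equiv.subtypeUnivEquiv (fun x => Finset.mem_univ x))
  let g : Fin 2 → Fin M := fun i =>
    ((({m, n} : Finset (Fin M)).orderIsoOfFin hc (e.symm i) : ({m, n} : Finset (Fin M))) : Fin M)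
  have hg : Function.Injective g := by
    intro i j hij
    exact e.symm.injective ((({m, n} : Finset (Fin M)).orderIsoOfFin hc).injective
      (Subtype.ext hij))
  have hmem : ∀ i, g i = m ∨ g i = n := by
    intro i
    have := (({m, n} : Finset (Fin M)).orderIsoOfFin hc (e.symm i)).2
    rw [Finset.mem_insert, Finset.mem_singleton] at this
    exact this
  have hA : ∀ A : Matrix (Fin 2) (Fin M) ℝ, minor A Finset.univ {m, n} =
      A 0 (g 0) * A 1 (g 1) - A 0 (g 1) * A 1 (g 0) := by
    intro A
    unfold minor
    rw [dif_pos hc, ← Matrix.det_submatrix_equiv_self e.symm, Matrix.det_fin_two]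
    have he : ∀ i, (((Finset.univ : Finset (Fin 2)).orderIsoOfFin rfl (e.symm i) :
        (Finset.univ : Finset (Fin 2))) : Fin 2) = i := fun i => e.apply_symm_apply i
    simp only [Matrix.submatrix_apply, Matrix.of_apply, he]
    rfl
  rw [hA, hA]
  have h01 : g 0 ≠ g 1 := fun h => by simpa using hg h
  rcases hmem 0 with h0 | h0 <;> rcases hmem 1 with h1 | h1
  · exact absurd (h0.trans h1.symm) h01
  · rw [h0, h1]
  · rw [h0, h1]; ring
  · exact absurd (h0.trans h1.symm) h01

theorem cauchy_binet_aux {M : ℕ} (S B : Matrix (Fin 2) (Fin M) ℝ) (c : Fin M → ℝ) :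
    2 * ((∑ m, S 0 m * c m * B 0 m) * (∑ m, S 1 m * c m * B 1 m)
      - (∑ m, S 0 m * c m * B 1 m) * (∑ m, S 1 m * c m * B 0 m)) =
    ∑ m, ∑ n, c m * c n *
      ((S 0 m * S 1 n - S 0 n * S 1 m) * (B 0 m * B 1 n - B 0 n * B 1 m)) := by
  have h1 : (∑ m, S 0 m * c m * B 0 m) * (∑ m, S 1 m * c m * B 1 m)
      - (∑ m, S 0 m * c m * B 1 m) * (∑ m, S 1 m * c m * B 0 m) =
      ∑ m, ∑ n, c m * c n * (S 0 m * S 1 n * (B 0 m * B 1 n - B 0 n * B 1 m)) := by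
    rw [Finset.sum_mul_sum, Finset.sum_mul_sum, ← Finset.sum_sub_distrib]
    refine Finset.sum_congr rfl fun m _ => ?_
    rw [← Finset.sum_sub_distrib]
    exact Finset.sum_congr rfl fun n _ => by ring
  have h2 := h1
  rw [Finset.sum_comm] at h2
  rw [two_mul]
  nth_rewrite 1 [h1]
  rw [h2, ← Finset.sum_add_distrib]
  refine Finset.sum_congr rfl fun m _ => ?_
  rw [← Finset.sum_add_distrib]
  exact Finset.sum_congr rfl fun n _ => by ring

theorem sum_pos_aux {M : ℕ} (c : Fin M → ℝ) (hc : ∀ m, 0 < c m) (T : Fin M → Fin M → ℝ)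
    (hT : ∀ m n, 0 ≤ T m n) (h : ∑ m, ∑ n, T m n ≠ 0) :
    ∑ m, ∑ n, c m * c n * T m n ≠ 0 := by
  intro h0
  apply h
  have hnn : ∀ m n, 0 ≤ c m * c n * T m n := fun m n =>
    mul_nonneg (mul_pos (hc m) (hc n)).le (hT m n)
  refine Finset.sum_eq_zero fun m _ => Finset.sum_eq_zero fun n _ => ?_
  have h1 := (Finset.sum_eq_zero_iff_of_nonneg
    (fun m _ => Finset.sum_nonneg fun n _ => hnn m n)).1 h0 m (Finset.mem_univ m)
  have h2 := (Finset.sum_eq_zero_iff_of_nonneg (fun n _ => hnn m n)).1 h1 n (Finset.mem_univ n)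
  exact (mul_eq_zero.1 h2).resolve_left (mul_pos (hc m) (hc n)).ne'

theorem exp_aux (a b : ℝ) : ∃ c : ℝ, 0 < c ∧ Real.exp (-a) - Real.exp (-b) = - (c * (a - b)) := by
  rcases lt_trichotomy a b with h | h | h
  · refine ⟨(Real.exp (-a) - Real.exp (-b)) / (b - a), div_pos ?_ (by linarith), ?_⟩
    · have := Real.exp_lt_exp.2 (neg_lt_neg h); linarith
    · have : b - a ≠ 0 := by linarith
      field_simp; ring
  · exact ⟨1, one_pos, by simp [h]⟩
  · refine ⟨(Real.exp (-b) - Real.exp (-a)) / (a - b), div_pos ?_ (by linarith), ?_⟩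
    · have := Real.exp_lt_exp.2 (neg_lt_neg h); linarith
    · have : a - b ≠ 0 := by linarith
      field_simp; ring

/-- In DECT (`Q = K = 2`), under Assumption (A), `det(S Bᵀ) ≠ 0`,
and the same-sign condition for the full-size minor products, `F` is globally
injective on `ℝ²`. -/
theorem Fmap_injective_DECT (M : ℕ) (hM : 2 ≤ M)
    (S B : Matrix (Fin 2) (Fin M) ℝ)
    (hS : ∀ q m, 0 ≤ S q m) (hB : ∀ k m, 0 < B k m)
    (hScol : ∀ m, ∃ q, S q m ≠ 0)
    (hSrow : ∀ q, ∑ m, S q m = 1)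
    (hdet : (S * B.transpose).det ≠ 0)
    (hsign :
      (∀ β ∈ Finset.powersetCard 2 (Finset.univ : Finset (Fin M)),
        0 ≤ minor S Finset.univ β * minor B Finset.univ β) ∨
      (∀ β ∈ Finset.powersetCard 2 (Finset.univ : Finset (Fin M)),
        minor S Finset.univ β * minor B Finset.univ β ≤ 0)) :
    Function.Injective (Fmap S B) := by
  set T : Fin M → Fin M → ℝ := fun m n =>
    (S 0 m * S 1 n - S 0 n * S 1 m) * (B 0 m * B 1 n - B 0 n * B 1 m) with hTdef
  have hTdiag : ∀ m, T m m = 0 := fun m => by simp only [hTdef]; ring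
  have hTs : (∀ m n, 0 ≤ T m n) ∨ (∀ m n, 0 ≤ - T m n) := by
    rcases hsign with h | h
    · left
      intro m n
      by_cases hmn : m = n
      · subst hmn; exact (hTdiag m).ge
      · have := h {m, n} (by simp [Finset.mem_powersetCard, Finset.card_pair hmn])
        rwa [minor_prod_aux S B m n hmn] at this
    · right
      intro m n
      by_cases hmn : m = n
      · subst hmn; rw [hTdiag m]; simp
      · have := h {m, n} (by simp [Finset.mem_powersetCard, Finset.card_pair hmn])
        rw [minor_prod_aux S B m n hmn] at this
        exact neg_nonneg.2 this
  have hT0 : ∑ m, ∑ n, T m n ≠ 0 := by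
    have h := cauchy_binet_aux S B (fun _ => 1)
    simp only [mul_one, one_mul] at h
    change _ = ∑ m, ∑ n, T m n at h
    rw [← h]
    rw [Matrix.det_fin_two] at hdet
    simp only [Matrix.mul_apply, Matrix.transpose_apply] at hdet
    exact mul_ne_zero two_ne_zero hdet
  intro x y hxy
  have hpos : ∀ q (z : Fin 2 → ℝ), 0 < ∑ m, S q m * zeta B z m := by
    intro q z
    have hnn : ∀ m ∈ Finset.univ, 0 ≤ S q m * zeta B z m := fun m _ =>
      mul_nonneg (hS q m) (Real.exp_pos _).le
    refine lt_of_le_of_ne (Finset.sum_nonneg hnn) fun h0 => ?_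
    have h1 := (Finset.sum_eq_zero_iff_of_nonneg hnn).1 h0.symm
    have h2 : ∑ m, S q m = 0 := Finset.sum_eq_zero fun m hm =>
      (mul_eq_zero.1 (h1 m hm)).resolve_right (Real.exp_pos _).ne'
    rw [hSrow q] at h2
    exact one_ne_zero h2
  have heq : ∀ q, ∑ m, S q m * zeta B x m = ∑ m, S q m * zeta B y m := fun q =>
    Real.log_injOn_pos (hpos q x) (hpos q y) (congrFun hxy q)
  choose c hc hce using fun m : Fin M => exp_aux (∑ k, B k m * x k) (∑ k, B k m * y k)
  have hlin : ∀ q, (∑ m, S q m * c m * B 0 m) * (x 0 - y 0)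
      + (∑ m, S q m * c m * B 1 m) * (x 1 - y 1) = 0 := by
    intro q
    have h : ∑ m, S q m * (zeta B x m - zeta B y m) = 0 := by
      simp only [mul_sub, Finset.sum_sub_distrib, heq q, sub_self]
    rw [Finset.sum_mul, Finset.sum_mul, ← Finset.sum_add_distrib, ← neg_eq_zero, ← h,
      ← Finset.sum_neg_distrib]
    refine Finset.sum_congr rfl fun m _ => ?_
    unfold zeta
    rw [hce m]
    simp only [Fin.sum_univ_two]
    ring
  have hD : ∑ m, ∑ n, c m * c n * T m n ≠ 0 := by
    rcases hTs with h | h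
    · exact sum_pos_aux c hc T h hT0
    · have := sum_pos_aux c hc (fun m n => - T m n) h (by
        simpa only [Finset.sum_neg_distrib, neg_ne_zero] using hT0)
      simpa only [mul_neg, Finset.sum_neg_distrib, neg_ne_zero] using this
  rw [← cauchy_binet_aux S B c] at hD
  have hD' := right_ne_zero_of_mul hD
  have e0 := hlin 0
  have e1 := hlin 1
  generalize (∑ m, S 0 m * c m * B 0 m) = p at *
  generalize (∑ m, S 0 m * c m * B 1 m) = q at *
  generalize (∑ m, S 1 m * c m * B 0 m) = r at *
  generalize (∑ m, S 1 m * c m * B 1 m) = t at *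
  have v0 : (p * t - q * r) * (x 0 - y 0) = 0 := by linear_combination t * e0 - q * e1
  have v1 : (p * t - q * r) * (x 1 - y 1) = 0 := by linear_combination p * e1 - r * e0
  have w0 := (mul_eq_zero.1 v0).resolve_left hD'
  have w1 := (mul_eq_zero.1 v1).resolve_left hD'
  funext i
  fin_cases i
  · exact sub_eq_zero.1 w0
  · exact sub_eq_zero.1 w1
end
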